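/- (Cell entropy inequality for the explicit method.) Let A : ℝ → ℝ be nondecreasing and Lipschitz continuous with Lipschitz constant L_A and A(0) = 0, let Δt > 0 satisfy the CFL condition Δt · L_A · |G^β_β| ≤ 1 for every β ∈ ℤ^d, let u : ℤ^d → ℝ be bounded, and define v_α = u_α + Δt Σ_{β∈ℤ^d} G^α_β A(u_β). Then for every k ∈ ℝ, every r ∈ (Δx/2, 1] and every α ∈ ℤ^d, all sums below converge absolutely and |v_α − k| ≤ |u_α − k| + Δt Σ_{β∈ℤ^d} G^{α,r}_β |A(u_β) − A(k)| + Δt · sgn(v_α − k) · Σ_{β∈ℤ^d} G^α_{β,r} A(u_β), where sgn(t) = 1 for t > 0, sgn(t) = −1 for t < 0, and sgn(0) = 0. -/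

import Mathlib

open MeasureTheory Set

noncomputable section

abbrev Ed (d : ℕ) := EuclideanSpace ℝ (Fin d)

def cell (d : ℕ) (dx : ℝ) (α : Fin d → ℤ) : Set (Ed d) :=
  {x | ∀ i, dx * (α i : ℝ) < x i ∧ x i < dx * (α i : ℝ) + dx}

def ind (d : ℕ) (S : Set (Ed d)) : Ed d → ℝ :=
  S.indicator fun _ => 1

def gam (d : ℕ) (dx : ℝ) (μ : Measure (Ed d)) (l : Fin d) : ℝ :=
  - ∫ z in {z : Ed d | dx / 2 < ‖z‖ ∧ ‖z‖ ≤ 1}, z l ∂μ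

def Dup (d : ℕ) (dx : ℝ) (μ : Measure (Ed d)) (l : Fin d) (φ : Ed d → ℝ) (x : Ed d) : ℝ :=
  if 0 < gam d dx μ l then (φ (x + EuclideanSpace.single l dx) - φ x) / dx
  else (φ x - φ (x - EuclideanSpace.single l dx)) / dx

def Glow (d : ℕ) (dx : ℝ) (μ : Measure (Ed d)) (α β : Fin d → ℤ) : ℝ :=
  (dx ^ d)⁻¹ *
    ∫ x in cell d dx α, ∫ z in {z : Ed d | dx / 2 < ‖z‖},
      (ind d (cell d dx β) (x + z) - ind d (cell d dx β) x) ∂μ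

def Gup (d : ℕ) (dx : ℝ) (μ : Measure (Ed d)) (α β : Fin d → ℤ) : ℝ :=
  (dx ^ d)⁻¹ *
    ∑ l : Fin d, gam d dx μ l * ∫ x in cell d dx α, Dup d dx μ l (ind d (cell d dx β)) x

def Gw (d : ℕ) (dx : ℝ) (μ : Measure (Ed d)) (α β : Fin d → ℤ) : ℝ :=
  Glow d dx μ α β + Gup d dx μ α β

def GsplitLow (d : ℕ) (dx r : ℝ) (μ : Measure (Ed d)) (α β : Fin d → ℤ) : ℝ :=
  (dx ^ d)⁻¹ *
    ∫ x in cell d dx α, ∫ z in {z : Ed d | dx / 2 < ‖z‖ ∧ ‖z‖ ≤ r},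
      (ind d (cell d dx β) (x + z) - ind d (cell d dx β) x) ∂μ

def GsplitHigh (d : ℕ) (dx r : ℝ) (μ : Measure (Ed d)) (α β : Fin d → ℤ) : ℝ :=
  (dx ^ d)⁻¹ *
      ∫ x in cell d dx α, ∫ z in {z : Ed d | r < ‖z‖},
        (ind d (cell d dx β) (x + z) - ind d (cell d dx β) x) ∂μ
    + Gup d dx μ α β

def Aok (A : ℝ → ℝ) (LA : ℝ) : Prop :=
  Monotone A ∧ (∀ a b : ℝ, |A a - A b| ≤ LA * |a - b|) ∧ A 0 = 0

def SolvesImplicitStep (d : ℕ) (dx : ℝ) (μ : Measure (Ed d)) (A : ℝ → ℝ) (dt : ℝ)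
    (u h : (Fin d → ℤ) → ℝ) : Prop :=
  ∀ α, Summable (fun β => Gw d dx μ α β * A (u β)) ∧
    u α - dt * ∑' β, Gw d dx μ α β * A (u β) = h α

def Fractional (d : ℕ) (μ : Measure (Ed d)) (lam clam : ℝ) : Prop :=
  ∀ B : Set (Ed d), MeasurableSet B → B ⊆ {z : Ed d | 0 < ‖z‖ ∧ ‖z‖ < 1} →
    μ B ≤ ∫⁻ z in B, ENNReal.ofReal (clam * ‖z‖ ^ (-(d : ℝ) - lam))

def Lhat (d : ℕ) (dx : ℝ) (μ : Measure (Ed d)) (w : Ed d → ℝ) (x : Ed d) : ℝ :=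
  (∫ z in {z : Ed d | dx / 2 < ‖z‖}, (w (x + z) - w x) ∂μ) +
    ∑ l : Fin d, gam d dx μ l * Dup d dx μ l w x

def Ubar (d : ℕ) (dx : ℝ) (U : (Fin d → ℤ) → ℝ) (x : Ed d) : ℝ :=
  ∑' α : Fin d → ℤ, U α * ind d (cell d dx α) x

def cellAvg (d : ℕ) (dx : ℝ) (w : Ed d → ℝ) (x : Ed d) : ℝ :=
  ∑' α : Fin d → ℤ, Set.indicator (cell d dx α)
    (fun _ => (dx ^ d)⁻¹ * ∫ y in cell d dx α, w y) x


lemma isOpen_cell (d : ℕ) (dx : ℝ) (α : Fin d → ℤ) : IsOpen (cell d dx α) := by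
  simp only [cell, Set.ofPred_forall, Set.ofPred_and]
  refine isOpen_iInter_of_finite fun i => IsOpen.inter ?_ ?_
  · exact isOpen_lt (by fun_prop) (by fun_prop)
  · exact isOpen_lt (by fun_prop) (by fun_prop)

lemma measurableSet_cell (d : ℕ) (dx : ℝ) (α : Fin d → ℤ) : MeasurableSet (cell d dx α) :=
  (isOpen_cell d dx α).measurableSet

lemma pairwise_disjoint_cell (d : ℕ) {dx : ℝ} (hdx : 0 < dx) :
    Pairwise (Function.onFun Disjoint (cell d dx)) := by
  intro α β hαβ
  refine Set.disjoint_left.2 fun x hα hβ => hαβ (funext fun i => ?_)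
  have key : ∀ a b : ℤ, dx * (a : ℝ) < x i → x i < dx * (b : ℝ) + dx → a ≤ b := by
    intro a b h1 h2
    have h : dx * (a : ℝ) < dx * ((b : ℝ) + 1) := by linarith
    have h' : (a : ℝ) < (b : ℝ) + 1 := lt_of_mul_lt_mul_left h hdx.le
    exact Int.lt_add_one_iff.1 (by exact_mod_cast h')
  exact le_antisymm (key _ _ (hα i).1 (hβ i).2) (key _ _ (hβ i).1 (hα i).2)

lemma volume_cell (d : ℕ) (dx : ℝ) (α : Fin d → ℤ) :
    volume (cell d dx α) = ENNReal.ofReal dx ^ d := by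
  have h : cell d dx α = (MeasurableEquiv.toLp 2 (Fin d → ℝ)).symm ⁻¹'
      univ.pi fun i => Set.Ioo (dx * (α i : ℝ)) (dx * (α i : ℝ) + dx) := by
    ext x
    simp [cell]
  rw [h, (EuclideanSpace.volume_preserving_symm_measurableEquiv_toLp (Fin d)).measure_preimage
    (MeasurableSet.univ_pi fun _ => measurableSet_Ioo).nullMeasurableSet, Real.volume_pi_Ioo]
  simp

lemma volume_coord_eq_zero (d : ℕ) (i : Fin d) (c : ℝ) :
    volume {x : Ed d | x i = c} = 0 := by
  have h : {x : Ed d | x i = c} = (MeasurableEquiv.toLp 2 (Fin d → ℝ)).symm ⁻¹'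
      {y : Fin d → ℝ | y i = c} := rfl
  rw [h, (EuclideanSpace.volume_preserving_symm_measurableEquiv_toLp (Fin d)).measure_preimage
    (measurableSet_eq_fun (measurable_pi_apply i) measurable_const).nullMeasurableSet]
  exact Measure.pi_hyperplane (fun _ : Fin d => (volume : Measure ℝ)) i c

lemma volume_compl_iUnion_cell (d : ℕ) {dx : ℝ} (hdx : 0 < dx) :
    volume (⋃ β, cell d dx β)ᶜ = 0 := by
  refine measure_mono_null (t := ⋃ (i : Fin d) (n : ℤ), {x : Ed d | x i = dx * (n : ℝ)}) ?_
    (measure_iUnion_null fun i => measure_iUnion_null fun n => volume_coord_eq_zero d i _)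
  intro x hx
  by_contra hcon
  simp only [mem_iUnion, Set.mem_ofPred_eq, not_exists] at hcon
  refine hx (mem_iUnion.2 ⟨fun i => ⌊x i / dx⌋, fun i => ⟨?_, ?_⟩⟩)
  · have h := (le_div_iff₀ hdx).1 (Int.floor_le (x i / dx))
    exact lt_of_le_of_ne (by linarith) (Ne.symm (hcon i _))
  · have h := (div_lt_iff₀ hdx).1 (Int.lt_floor_add_one (x i / dx))
    linarith

lemma hasSum_measureReal_preimage_cell {X : Type*} [MeasurableSpace X] (d : ℕ) {dx : ℝ}
    (hdx : 0 < dx) (P : Measure X) [IsFiniteMeasure P] {T : X → Ed d} (hT : Measurable T) :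
    HasSum (fun β => P.real (T ⁻¹' cell d dx β)) (P.real (T ⁻¹' ⋃ β, cell d dx β)) := by
  have h : P (T ⁻¹' ⋃ β, cell d dx β) = ∑' β, P (T ⁻¹' cell d dx β) := by
    rw [preimage_iUnion]
    exact measure_iUnion (fun α β h => (pairwise_disjoint_cell d hdx h).preimage T)
      fun β => hT (measurableSet_cell d dx β)
  rw [measureReal_def, h, ENNReal.tsum_toReal_eq fun β => measure_ne_top P _]
  exact ENNReal.hasSum_toReal (h ▸ measure_ne_top P _)

lemma integrable_ind_comp {X : Type*} [MeasurableSpace X] (d : ℕ) (dx : ℝ) (P : Measure X)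
    [IsFiniteMeasure P] {T : X → Ed d} (hT : Measurable T) (β : Fin d → ℤ) :
    Integrable (fun x => ind d (cell d dx β) (T x)) P :=
  (integrable_const (1 : ℝ)).indicator (hT (measurableSet_cell d dx β))

lemma integral_ind_comp {X : Type*} [MeasurableSpace X] (d : ℕ) (dx : ℝ) (P : Measure X)
    {T : X → Ed d} (hT : Measurable T) (β : Fin d → ℤ) :
    ∫ x, ind d (cell d dx β) (T x) ∂P = P.real (T ⁻¹' cell d dx β) :=
  integral_indicator_one (hT (measurableSet_cell d dx β))

lemma ind_nonneg (d : ℕ) (S : Set (Ed d)) (x : Ed d) : 0 ≤ ind d S x :=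
  indicator_nonneg (fun _ _ => zero_le_one) x

lemma ind_le_one (d : ℕ) (S : Set (Ed d)) (x : Ed d) : ind d S x ≤ 1 :=
  indicator_le' (fun _ _ => le_rfl) (fun _ _ => zero_le_one) x

lemma ind_of_mem {d : ℕ} {S : Set (Ed d)} {x : Ed d} (hx : x ∈ S) : ind d S x = 1 :=
  indicator_of_mem hx _

/-- The jump integral of the indicator of a cell, for a finite jump measure. -/
def jumpInt (d : ℕ) (dx : ℝ) (m : Measure (Ed d)) (α β : Fin d → ℤ) : ℝ :=
  ∫ x in cell d dx α, ∫ z, (ind d (cell d dx β) (x + z) - ind d (cell d dx β) x) ∂m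

instance isFiniteMeasure_restrict_cell (d : ℕ) (dx : ℝ) (α : Fin d → ℤ) :
    IsFiniteMeasure ((volume : Measure (Ed d)).restrict (cell d dx α)) :=
  isFiniteMeasure_restrict.2 (by simp [volume_cell])

section

variable (d : ℕ) (dx : ℝ) (m : Measure (Ed d)) [IsFiniteMeasure m] (α : Fin d → ℤ)

lemma jumpInt_eq (β : Fin d → ℤ) :
    jumpInt d dx m α β =
      ((volume.restrict (cell d dx α)).prod m).real ((fun p => p.1 + p.2) ⁻¹' cell d dx β) -
      ((volume.restrict (cell d dx α)).prod m).real (Prod.fst ⁻¹' cell d dx β) := by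
  have h1 := integrable_ind_comp d dx ((volume.restrict (cell d dx α)).prod m)
    (T := fun p => p.1 + p.2) (by fun_prop) β
  have h2 := integrable_ind_comp d dx ((volume.restrict (cell d dx α)).prod m)
    (T := Prod.fst) (by fun_prop) β
  rw [jumpInt, ← integral_ind_comp d dx _ (by fun_prop),
    ← integral_ind_comp d dx _ (by fun_prop), ← integral_sub h1 h2]
  exact (integral_prod _ (h1.sub h2)).symm

lemma integrable_jump_integral (β : Fin d → ℤ) :
    IntegrableOn
      (fun x => ∫ z, (ind d (cell d dx β) (x + z) - ind d (cell d dx β) x) ∂m)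
      (cell d dx α) := by
  have h1 := integrable_ind_comp d dx ((volume.restrict (cell d dx α)).prod m)
    (T := fun p => p.1 + p.2) (by fun_prop) β
  have h2 := integrable_ind_comp d dx ((volume.restrict (cell d dx α)).prod m)
    (T := Prod.fst) (by fun_prop) β
  exact (h1.sub h2).integral_prod_left

lemma jumpInt_add (m' : Measure (Ed d)) [IsFiniteMeasure m'] (β : Fin d → ℤ) :
    jumpInt d dx (m + m') α β = jumpInt d dx m α β + jumpInt d dx m' α β := by
  rw [jumpInt_eq, jumpInt_eq, jumpInt_eq, Measure.prod_add, measureReal_add_apply,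
    measureReal_add_apply]
  ring

lemma hasSum_jumpInt (hdx : 0 < dx) : HasSum (jumpInt d dx m α) 0 := by
  have h1 := hasSum_measureReal_preimage_cell d hdx ((volume.restrict (cell d dx α)).prod m)
    (T := fun p => p.1 + p.2) (by fun_prop)
  have h2 := hasSum_measureReal_preimage_cell d hdx ((volume.restrict (cell d dx α)).prod m)
    (T := Prod.fst) (by fun_prop)
  have hN : MeasurableSet (⋃ β, cell d dx β) :=
    MeasurableSet.iUnion fun β => measurableSet_cell d dx β
  have key : ∀ T : Ed d × Ed d → Ed d, Measurable T →
      (∀ z, volume ((fun x => T (x, z)) ⁻¹' (⋃ β, cell d dx β)ᶜ) = 0) →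
      ((volume.restrict (cell d dx α)).prod m).real (T ⁻¹' ⋃ β, cell d dx β) =
        ((volume.restrict (cell d dx α)).prod m).real univ := by
    intro T hT hz
    rw [← measureReal_add_measureReal_compl (hT hN)]
    suffices h : ((volume.restrict (cell d dx α)).prod m) (T ⁻¹' ⋃ β, cell d dx β)ᶜ = 0 by
      rw [measureReal_def _ (_)ᶜ, h, ENNReal.toReal_zero, add_zero]
    rw [Measure.prod_apply_symm (hT hN).compl, lintegral_eq_zero_of_ae_eq_zero]
    exact Filter.Eventually.of_forall fun z => le_antisymm
      ((Measure.restrict_apply_le _ _).trans (hz z).le) zero_le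
  rw [key _ (by fun_prop) fun z => ?_] at h1
  · rw [key Prod.fst measurable_fst fun z => volume_compl_iUnion_cell d hdx] at h2
    have h := h1.sub h2
    rw [sub_self] at h
    exact h.congr_fun fun β => jumpInt_eq d dx m α β
  · exact (measure_preimage_add_right volume z _).trans (volume_compl_iUnion_cell d hdx)

end

lemma jumpInt_nonneg (d : ℕ) {dx : ℝ} (hdx : 0 < dx) (m : Measure (Ed d))
    {α β : Fin d → ℤ} (h : β ≠ α) : 0 ≤ jumpInt d dx m α β := by
  refine setIntegral_nonneg (measurableSet_cell d dx α) fun x hx => integral_nonneg fun z => ?_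
  have hx' : ind d (cell d dx β) x = 0 :=
    indicator_of_notMem (Set.disjoint_right.1 (pairwise_disjoint_cell d hdx h) hx) _
  simpa [hx'] using ind_nonneg d _ (x + z)

lemma jumpInt_self_nonpos (d : ℕ) (dx : ℝ) (m : Measure (Ed d)) (α : Fin d → ℤ) :
    jumpInt d dx m α α ≤ 0 := by
  refine setIntegral_nonpos (measurableSet_cell d dx α) fun x hx => integral_nonpos fun z => ?_
  simpa [ind_of_mem hx] using ind_le_one d _ (x + z)

lemma Gup_self_nonpos (d : ℕ) {dx : ℝ} (hdx : 0 < dx) (μ : Measure (Ed d)) (α : Fin d → ℤ) :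
    Gup d dx μ α α ≤ 0 := by
  refine mul_nonpos_of_nonneg_of_nonpos (by positivity) (Finset.sum_nonpos fun l _ => ?_)
  by_cases hg : 0 < gam d dx μ l
  · refine mul_nonpos_of_nonneg_of_nonpos hg.le
      (setIntegral_nonpos (measurableSet_cell d dx α) fun x hx => ?_)
    rw [Dup, if_pos hg, ind_of_mem hx]
    exact div_nonpos_of_nonpos_of_nonneg (sub_nonpos.2 (ind_le_one d _ _)) hdx.le
  · refine mul_nonpos_of_nonpos_of_nonneg (not_lt.1 hg)
      (setIntegral_nonneg (measurableSet_cell d dx α) fun x hx => ?_)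
    rw [Dup, if_neg hg, ind_of_mem hx]
    exact div_nonneg (sub_nonneg.2 (ind_le_one d _ _)) hdx.le

lemma summable_Gup (d : ℕ) {dx : ℝ} (hdx : 0 < dx) (μ : Measure (Ed d)) (α : Fin d → ℤ) :
    Summable (Gup d dx μ α) := by
  have hs : ∀ T S : Ed d → Ed d, Measurable T → Measurable S → Summable fun β =>
      ∫ x in cell d dx α, (ind d (cell d dx β) (T x) - ind d (cell d dx β) (S x)) / dx := by
    intro T S hT hS
    have h := ((hasSum_measureReal_preimage_cell d hdx (volume.restrict (cell d dx α))
      hT).summable.sub (hasSum_measureReal_preimage_cell d hdx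
        (volume.restrict (cell d dx α)) hS).summable).div_const dx
    refine h.congr fun β => ?_
    rw [integral_div, integral_sub (integrable_ind_comp d dx _ hT β)
      (integrable_ind_comp d dx _ hS β), integral_ind_comp d dx _ hT, integral_ind_comp d dx _ hS]
  refine (summable_sum fun l _ => Summable.mul_left _ ?_).mul_left _
  by_cases hg : 0 < gam d dx μ l
  · simpa only [Dup, if_pos hg, id] using hs (fun x => x + EuclideanSpace.single l dx) id
      (by fun_prop) (by fun_prop)
  · simpa only [Dup, if_neg hg, id] using hs id (fun x => x - EuclideanSpace.single l dx)
      (by fun_prop) (by fun_prop)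

lemma measure_norm_gt_lt_top {E : Type*} [NormedAddCommGroup E] [MeasurableSpace E]
    [OpensMeasurableSpace E] {μ : Measure E}
    (hμ : ∫⁻ z, ENNReal.ofReal (min (‖z‖ ^ 2) 1) ∂μ < ⊤) {ε : ℝ} (hε : 0 < ε) :
    μ {z | ε < ‖z‖} < ⊤ := by
  have hpos : 0 < min (ε ^ 2) 1 := by positivity
  refine (measure_mono (t := {z | ENNReal.ofReal (min (ε ^ 2) 1) ≤
    ENNReal.ofReal (min (‖z‖ ^ 2) 1)}) fun z hz => ?_).trans_lt
    ((meas_ge_le_lintegral_div (by fun_prop) (ENNReal.ofReal_pos.2 hpos).ne'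
      ENNReal.ofReal_ne_top).trans_lt (ENNReal.div_lt_top hμ.ne (ENNReal.ofReal_pos.2 hpos).ne'))
  have hz' : ε < ‖z‖ := hz
  exact ENNReal.ofReal_le_ofReal (min_le_min_right _ (by gcongr))

/-- A summable family multiplied by a bounded one is summable. -/
lemma Summable.mul_bounded {ι : Type*} {f g : ι → ℝ} (hf : Summable f) {C : ℝ}
    (hg : ∀ i, |g i| ≤ C) : Summable fun i => f i * g i :=
  Summable.of_norm_bounded (hf.abs.mul_right C) fun i => by
    rw [Real.norm_eq_abs, abs_mul]
    exact mul_le_mul_of_nonneg_left (hg i) (abs_nonneg _)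

/-- Kruzhkov-type estimate for an update with weights that are nonnegative off the diagonal. -/
lemma abs_le_add_tsum_of_offdiag_nonneg {ι : Type*} {g w : ι → ℝ} {x y t h : ℝ} (i : ι)
    (hg : ∀ j, j ≠ i → 0 ≤ g j) (s1 : Summable fun j => g j * |w j|)
    (s2 : Summable fun j => g j * w j) (hxw : x ≤ 0 ∧ w i ≤ 0 ∨ 0 ≤ x ∧ 0 ≤ w i) (ht : 0 ≤ t)
    (hdiag : t * |g i| * |w i| ≤ |x|) (hy : y = x + t * ∑' j, g j * w j + t * h) :
    |y| ≤ |x| + t * ∑' j, g j * |w j| + t * Real.sign y * h := by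
  obtain ⟨σ, hσ⟩ : ∃ σ, σ = Real.sign y := ⟨_, rfl⟩
  rw [← hσ]
  have hσ1 : |σ| ≤ 1 := by
    rcases Real.sign_apply_eq y with h | h | h <;> simp [hσ, h]
  have hσy : |y| = σ * y := by
    rcases lt_trichotomy y 0 with h | h | h
    · rw [hσ, Real.sign_of_neg h, abs_of_neg h]
      ring
    · simp [h]
    · rw [hσ, Real.sign_of_pos h, abs_of_pos h, one_mul]
  obtain ⟨hσl, hσu⟩ := abs_le.1 hσ1
  have hterm : g i * |w i| - σ * (g i * w i) ≤
      ∑' j, g j * |w j| - σ * ∑' j, g j * w j := by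
    rw [← tsum_mul_left, ← s1.tsum_sub (s2.mul_left σ)]
    refine (s1.sub (s2.mul_left σ)).le_tsum i fun j hj => ?_
    have hle : σ * w j ≤ |w j| := by
      refine (le_abs_self _).trans ?_
      rw [abs_mul]
      exact mul_le_of_le_one_left (abs_nonneg _) hσ1
    linarith [mul_le_mul_of_nonneg_left hle (hg j hj)]
  have hdiag' : 0 ≤ |x| - σ * x + t * (g i * |w i| - σ * (g i * w i)) := by
    have hlin : 0 ≤ |x| + t * g i * |w i| := by
      have := mul_le_mul_of_nonneg_right (neg_abs_le (g i)) (mul_nonneg ht (abs_nonneg (w i)))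
      linarith
    rcases hxw with ⟨hx, hw⟩ | ⟨hx, hw⟩
    · rw [abs_of_nonpos hx, abs_of_nonpos hw] at hlin ⊢
      linarith [mul_nonneg (by linarith : 0 ≤ 1 + σ) hlin]
    · rw [abs_of_nonneg hx, abs_of_nonneg hw] at hlin ⊢
      linarith [mul_nonneg (by linarith : 0 ≤ 1 - σ) hlin]
  rw [hσy, hy]
  linarith [mul_le_mul_of_nonneg_left hterm ht]

theorem stmt10 (d : ℕ) (hd : 1 ≤ d) (dx : ℝ) (hdx0 : 0 < dx) (hdx1 : dx < 1)
    (μ : Measure (Ed d)) (hμ0 : μ {0} = 0)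
    (hμfin : ∫⁻ z, ENNReal.ofReal (min (‖z‖ ^ 2) 1) ∂μ < ⊤)
    (A : ℝ → ℝ) (LA : ℝ) (hA : Aok A LA) (dt : ℝ) (hdt : 0 < dt)
    (hCFL : ∀ β : Fin d → ℤ, dt * LA * |Gw d dx μ β β| ≤ 1)
    (u : (Fin d → ℤ) → ℝ) (hu : ∃ M : ℝ, ∀ α, |u α| ≤ M)
    (v : (Fin d → ℤ) → ℝ)
    (hv : ∀ α : Fin d → ℤ, v α = u α + dt * ∑' β : Fin d → ℤ, Gw d dx μ α β * A (u β)) :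
    ∀ (k r : ℝ), dx / 2 < r → r ≤ 1 → ∀ α : Fin d → ℤ,
      Summable (fun β : Fin d → ℤ => GsplitLow d dx r μ α β * |A (u β) - A k|) ∧
      Summable (fun β : Fin d → ℤ => GsplitHigh d dx r μ α β * A (u β)) ∧
      |v α - k| ≤ |u α - k|
        + dt * ∑' β : Fin d → ℤ, GsplitLow d dx r μ α β * |A (u β) - A k|
        + dt * Real.sign (v α - k) * ∑' β : Fin d → ℤ, GsplitHigh d dx r μ α β * A (u β) := by
  intro k r hr _ α
  obtain ⟨hmono, hLip, hA0⟩ := hA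
  obtain ⟨M, hM⟩ := hu
  have hLA : 0 ≤ LA := by simpa using (abs_nonneg _).trans (hLip 1 0)
  have hdxd : 0 ≤ (dx ^ d)⁻¹ := by positivity
  have hfin : μ {z : Ed d | dx / 2 < ‖z‖} < ⊤ := measure_norm_gt_lt_top hμfin (by positivity)
  have : IsFiniteMeasure (μ.restrict {z : Ed d | dx / 2 < ‖z‖ ∧ ‖z‖ ≤ r}) :=
    isFiniteMeasure_restrict.2 ((measure_mono fun z hz => hz.1).trans_lt hfin).ne
  have : IsFiniteMeasure (μ.restrict {z : Ed d | r < ‖z‖}) :=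
    isFiniteMeasure_restrict.2 ((measure_mono fun z hz => hr.trans hz).trans_lt hfin).ne
  have hlow : ∀ β, GsplitLow d dx r μ α β =
      (dx ^ d)⁻¹ * jumpInt d dx (μ.restrict {z | dx / 2 < ‖z‖ ∧ ‖z‖ ≤ r}) α β := fun _ => rfl
  have hhigh : ∀ β, GsplitHigh d dx r μ α β =
      (dx ^ d)⁻¹ * jumpInt d dx (μ.restrict {z | r < ‖z‖}) α β + Gup d dx μ α β := by
    intro β
    have hvol : volume.real (cell d dx α) = dx ^ d := by
      simp [measureReal_def, volume_cell, hdx0.le]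
    rw [GsplitHigh, integral_add (integrable_jump_integral d dx _ α β) (integrable_const _),
      setIntegral_const, hvol, smul_eq_mul, mul_add, inv_mul_cancel_left₀ (by positivity)]
    rfl
  have hG : ∀ β, Gw d dx μ α β = GsplitLow d dx r μ α β + GsplitHigh d dx r μ α β := by
    intro β
    have hset : {z : Ed d | dx / 2 < ‖z‖} =
        {z | dx / 2 < ‖z‖ ∧ ‖z‖ ≤ r} ∪ {z | r < ‖z‖} := by
      ext z
      simp only [Set.mem_ofPred_eq, mem_union]
      grind
    have hdisj : Disjoint {z : Ed d | dx / 2 < ‖z‖ ∧ ‖z‖ ≤ r} {z | r < ‖z‖} :=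
      Set.disjoint_left.2 fun z hz hz' => not_lt.2 hz.2 hz'
    have hmeas : MeasurableSet {z : Ed d | r < ‖z‖} :=
      measurableSet_lt measurable_const measurable_norm
    have hglow : Glow d dx μ α β =
        (dx ^ d)⁻¹ * jumpInt d dx (μ.restrict {z | dx / 2 < ‖z‖}) α β := rfl
    rw [Gw, hglow, hset, Measure.restrict_union hdisj hmeas, jumpInt_add, hlow, hhigh]
    ring
  have hlow_sum : HasSum (GsplitLow d dx r μ α) 0 := by
    have h := (hasSum_jumpInt d dx (μ.restrict {z | dx / 2 < ‖z‖ ∧ ‖z‖ ≤ r}) α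
      hdx0).mul_left (dx ^ d)⁻¹
    rw [mul_zero] at h
    exact h.congr_fun hlow
  have hhigh_sum : Summable (GsplitHigh d dx r μ α) :=
    ((hasSum_jumpInt d dx (μ.restrict {z | r < ‖z‖}) α hdx0).summable.mul_left _).add
      (summable_Gup d hdx0 μ α) |>.congr fun β => (hhigh β).symm
  have hAu : ∀ β, |A (u β)| ≤ LA * M := fun β => by
    have h := hLip (u β) 0
    rw [hA0, sub_zero, sub_zero] at h
    exact h.trans (mul_le_mul_of_nonneg_left (hM β) hLA)
  have hAk : ∀ β, |A (u β) - A k| ≤ LA * M + |A k| := fun β =>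
    (abs_sub _ _).trans (by linarith [hAu β])
  have s1 : Summable fun β => GsplitLow d dx r μ α β * |A (u β) - A k| :=
    hlow_sum.summable.mul_bounded fun β => (abs_abs _).trans_le (hAk β)
  have s2 := hhigh_sum.mul_bounded hAu
  have s3 := hlow_sum.summable.mul_bounded hAk
  refine ⟨s1, s2, ?_⟩
  have hvk : v α - k = u α - k + dt * ∑' β, GsplitLow d dx r μ α β * (A (u β) - A k) +
      dt * ∑' β, GsplitHigh d dx r μ α β * A (u β) := by
    have h : HasSum (fun β => Gw d dx μ α β * A (u β))
        (∑' β, GsplitLow d dx r μ α β * (A (u β) - A k) + 0 * A k +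
          ∑' β, GsplitHigh d dx r μ α β * A (u β)) :=
      ((s3.hasSum.add (hlow_sum.mul_right (A k))).add s2.hasSum).congr_fun fun β => by
        rw [hG]
        ring
    rw [hv α, h.tsum_eq]
    ring
  have hdiag : dt * |GsplitLow d dx r μ α α| * |A (u α) - A k| ≤ |u α - k| := by
    have hl : GsplitLow d dx r μ α α ≤ 0 := by
      rw [hlow]
      exact mul_nonpos_of_nonneg_of_nonpos hdxd (jumpInt_self_nonpos d dx _ α)
    have hh : GsplitHigh d dx r μ α α ≤ 0 := by
      rw [hhigh]
      exact add_nonpos (mul_nonpos_of_nonneg_of_nonpos hdxd (jumpInt_self_nonpos d dx _ α))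
        (Gup_self_nonpos d hdx0 μ α)
    have hle : |GsplitLow d dx r μ α α| ≤ |Gw d dx μ α α| := by
      rw [hG, abs_of_nonpos hl, abs_of_nonpos (add_nonpos hl hh)]
      linarith
    calc dt * |GsplitLow d dx r μ α α| * |A (u α) - A k|
        ≤ dt * |Gw d dx μ α α| * (LA * |u α - k|) := by
          gcongr
          exact hLip _ _
      _ = dt * LA * |Gw d dx μ α α| * |u α - k| := by ring
      _ ≤ 1 * |u α - k| := by
          gcongr
          exact hCFL α
      _ = |u α - k| := one_mul _
  refine abs_le_add_tsum_of_offdiag_nonneg α (fun β hβ => ?_) s1 s3 ?_ hdt.le hdiag hvk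
  · exact (hlow β).symm ▸ mul_nonneg hdxd (jumpInt_nonneg d hdx0 _ hβ)
  · rcases le_total (u α) k with h | h
    · exact Or.inl ⟨sub_nonpos.2 h, sub_nonpos.2 (hmono h)⟩
    · exact Or.inr ⟨sub_nonneg.2 h, sub_nonneg.2 (hmono h)⟩
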